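/- arXiv:2010.04961 — 2 statements merged into one kernel-verified Lean document; each statement's English description precedes it below -/
import Mathlib

section
/- In a structured semigroup (S, N, Z) in which N is diagonal, every subset C ⊆ S satisfies: (i) C^{*<} ⊆ C^*; (ii) C^{**} = C^{<<}; and (iii) C^{***} ⊆ C^*. -/
open Pointwise

variable {S : Type*}

/-- `a <_s b`: the domination relation via `s`. -/
def domBy [Semigroup S] (N Z : Set S) (a s b : S) : Prop :=
  a * s * b = a ∧ b * s * a = a ∧ a * s ∈ N ∧ s * a ∈ N ∧ b * s ∈ Z ∧ s * b ∈ Z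

/-- `a < b`: domination. -/
def domRel [Semigroup S] (N Z : Set S) (a b : S) : Prop := ∃ s, domBy N Z a s b

/-- The up-closure `A^<`. -/
def upClo [Semigroup S] (N Z : Set S) (A : Set S) : Set S :=
  {b | ∃ a ∈ A, domRel N Z a b}

/-- The dual `A^*`. -/
def dualSet [Semigroup S] (N Z : Set S) (A : Set S) : Set S :=
  {s | ∃ a ∈ A, ∃ b, domBy N Z a s b}

/-- Structured semigroup data on `(S, N, Z)`. -/
structure Structured [Semigroup S] (N Z : Set S) : Prop where
  nMul : ∀ m ∈ N, ∀ n ∈ N, m * n ∈ N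
  zMul : ∀ y ∈ Z, ∀ z ∈ Z, y * z ∈ Z
  zSubN : Z ⊆ N
  zComm : ∀ z ∈ Z, ∀ n ∈ N, z * n = n * z
  binormal : ∀ a b : S, a * b ∈ Z → b * a ∈ Z → ∀ z ∈ Z, a * z * b ∈ Z ∧ b * z * a ∈ Z
  trinormal : ∀ a b : S, ∀ n ∈ N, a * b * n = n → n * a * b = n →
    a * b ∈ Z → b * a ∈ Z → b * n * a ∈ N

/-- An atlas: `A A^* A ⊆ A ⊆ A^<`. -/
def IsAtlas [Semigroup S] (N Z : Set S) (A : Set S) : Prop :=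
  A * dualSet N Z A * A ⊆ A ∧ A ⊆ upClo N Z A

/-- A coset: `A A^* A ⊆ A = A^<`. -/
def IsCoset [Semigroup S] (N Z : Set S) (A : Set S) : Prop :=
  A * dualSet N Z A * A ⊆ A ∧ upClo N Z A = A

/-- Source `s(A) = (A^* A)^<`. -/
def srcSet [Semigroup S] (N Z : Set S) (A : Set S) : Set S :=
  upClo N Z (dualSet N Z A * A)

/-- Range `r(A) = (A A^*)^<`. -/
def rngSet [Semigroup S] (N Z : Set S) (A : Set S) : Set S :=
  upClo N Z (A * dualSet N Z A)

/-- `A|b`: `b` acts on `A` from the right. -/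
def actsR [Semigroup S] (Z : Set S) (A : Set S) (b : S) : Prop :=
  ∃ b', b * b' ∈ Z ∧ b' * b ∈ Z ∧ ∃ a ∈ A, a * b * b' = a

/-- `b|A`: `b` acts on `A` from the left. -/
def actsL [Semigroup S] (Z : Set S) (b : S) (A : Set S) : Prop :=
  ∃ b', b * b' ∈ Z ∧ b' * b ∈ Z ∧ ∃ a ∈ A, b' * b * a = a

/-- `A^Z = {z ∈ Z : az = a for some a ∈ A}`. -/
def AZset [Semigroup S] (Z : Set S) (A : Set S) : Set S :=
  {z ∈ Z | ∃ a ∈ A, a * z = a}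

/-- `^Z A = {z ∈ Z : za = a for some a ∈ A}`. -/
def ZAset [Semigroup S] (Z : Set S) (A : Set S) : Set S :=
  {z ∈ Z | ∃ a ∈ A, z * a = a}

/-- The equivalence relation `a ~_A b`. -/
def eqvA [Semigroup S] (N Z : Set S) (A : Set S) (a b : S) : Prop :=
  ∃ s ∈ dualSet N Z A, ∃ t ∈ dualSet N Z A, s * a * t = s * b * t

/-- `Y` is symmetric: `ab ∈ Y → baba ∈ Y`. -/
def IsSymmetric [Semigroup S] (Y : Set S) : Prop :=
  ∀ a b : S, a * b ∈ Y → b * a * b * a ∈ Y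

/-- `D` is diagonal: `ad, d, db ∈ D → adb ∈ D`. -/
def IsDiagonal [Semigroup S] (D : Set S) : Prop :=
  ∀ a d b : S, a * d ∈ D → d ∈ D → d * b ∈ D → a * d * b ∈ D

/-- If `c <_s b` and `s <_t d`, then `c <_d tsb`. -/
theorem domBy_of_domBy_dual [Semigroup S] {N Z : Set S} (h : Structured N Z)
    (hdiag : IsDiagonal N) {c s b t d : S} (h₁ : domBy N Z c s b) (h₂ : domBy N Z s t d) :
    domBy N Z c d (t * s * b) := by
  obtain ⟨csb, bsc, hcs, hsc, hbs, hsb⟩ := h₁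
  obtain ⟨std, dts, hst, hts, hdt, htd⟩ := h₂
  have tsbd : t * (s * b) * d ∈ Z := (h.binormal d t hdt htd _ hsb).2
  have dbst : d * (b * s) * t ∈ Z := (h.binormal d t hdt htd _ hbs).1
  have bs_td := h.zComm _ hbs _ (h.zSubN htd)
  have tdc : t * d * c = c :=
    calc t * d * c = t * d * (b * s * c) := by rw [bsc]
      _ = b * s * (t * d) * c := by rw [← mul_assoc, bs_td]
      _ = b * (s * t * d) * c := by simp only [mul_assoc]
      _ = c := by rw [std, bsc]
  have hcd : c * d ∈ N := by
    have key := hdiag (c * d) (t * s) (b * d)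
      (by rwa [show c * d * (t * s) = c * (d * t * s) by simp only [mul_assoc], dts]) hts
      (h.zSubN (by simpa only [mul_assoc] using tsbd))
    rwa [show c * d * (t * s) * (b * d) = c * (d * t * s) * b * d by simp only [mul_assoc],
      dts, csb] at key
  have hdc : d * c ∈ N := by
    have key := hdiag (d * b) (s * t) (d * c)
      (h.zSubN (by simpa only [mul_assoc] using dbst)) hst
      (by rwa [show s * t * (d * c) = s * t * d * c by simp only [mul_assoc], std])
    rwa [show d * b * (s * t) * (d * c) = d * (b * (s * t * d) * c) by simp only [mul_assoc],
      std, bsc] at key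
  have hdtsb : d * (t * s * b) = s * b := by
    rw [show d * (t * s * b) = d * t * s * b by simp only [mul_assoc], dts]
  refine ⟨?_, ?_, hcd, hdc, by simpa only [mul_assoc] using tsbd, by rwa [hdtsb]⟩
  · rw [mul_assoc, hdtsb, ← mul_assoc, csb]
  · calc t * s * b * d * c = t * (s * b * (d * c)) := by simp only [mul_assoc]
      _ = t * d * c * s * b := by rw [h.zComm _ hsb _ hdc]; simp only [mul_assoc]
      _ = c := by rw [tdc, csb]

/-- If `c <_s b` and `s <_t d`, then `tsb <_d t`. -/
theorem domBy_mul_of_domBy_dual [Semigroup S] {N Z : Set S} (h : Structured N Z)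
    {c s b t d : S} (h₁ : domBy N Z c s b) (h₂ : domBy N Z s t d) :
    domBy N Z (t * s * b) d t := by
  obtain ⟨-, -, -, -, -, hsb⟩ := h₁
  obtain ⟨-, dts, -, -, hdt, htd⟩ := h₂
  have tsbd : t * (s * b) * d ∈ Z := (h.binormal d t hdt htd _ hsb).2
  have hdtsb : d * (t * s * b) = s * b := by
    rw [show d * (t * s * b) = d * t * s * b by simp only [mul_assoc], dts]
  refine ⟨?_, ?_, h.zSubN (by simpa only [mul_assoc] using tsbd),
    by rw [hdtsb]; exact h.zSubN hsb, htd, hdt⟩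
  · calc t * s * b * d * t = t * (s * b * (d * t)) := by simp only [mul_assoc]
      _ = t * (d * t * s) * b := by
        rw [h.zComm _ hsb _ (h.zSubN hdt)]; simp only [mul_assoc]
      _ = t * s * b := by rw [dts]
  · rw [mul_assoc, hdtsb, mul_assoc]

/-- Transitivity of domination: if `c <_s b` and `b <_t d`, then `c <_{sbt} d`. -/
theorem domBy_trans [Semigroup S] {N Z : Set S} (h : Structured N Z)
    {c s b t d : S} (h₁ : domBy N Z c s b) (h₂ : domBy N Z b t d) :
    domBy N Z c (s * b * t) d := by
  obtain ⟨csb, bsc, hcs, hsc, hbs, hsb⟩ := h₁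
  obtain ⟨btd, dtb, hbt, htb, hdt, htd⟩ := h₂
  have hct : c * t ∈ N := by
    have key := h.nMul _ hcs _ hbt
    rwa [← mul_assoc, csb] at key
  have htc : t * c ∈ N := by
    have key := h.nMul _ htb _ hsc
    rwa [show t * b * (s * c) = t * (b * s * c) by simp only [mul_assoc], bsc] at key
  have hcr : c * (s * b * t) = c * t := by simp only [← mul_assoc, csb]
  have hrd : s * b * t * d = s * b := by
    rw [show s * b * t * d = s * (b * t * d) by simp only [mul_assoc], btd]
  have dtc : d * t * c = c :=
    calc d * t * c = d * t * (b * s * c) := by rw [bsc]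
      _ = d * t * b * s * c := by simp only [mul_assoc]
      _ = c := by rw [dtb, bsc]
  refine ⟨?_, ?_, by rwa [hcr], ?_, ?_, by rwa [hrd]⟩
  · rw [mul_assoc, hrd, ← mul_assoc, csb]
  · calc d * (s * b * t) * c = d * (s * b * (t * c)) := by simp only [mul_assoc]
      _ = d * t * c * s * b := by rw [h.zComm _ hsb _ htc]; simp only [mul_assoc]
      _ = c := by rw [dtc, csb]
  · rw [mul_assoc]
    exact h.nMul _ (h.zSubN hsb) _ htc
  · rw [← mul_assoc]
    exact (h.binormal d t hdt htd _ hsb).1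

/-- If `sb ∈ Z` and `b <_t d`, then `sbt <_d t`. -/
theorem domBy_mul_of_mem [Semigroup S] {N Z : Set S} (h : Structured N Z)
    {s b t d : S} (hsb : s * b ∈ Z) (h₂ : domBy N Z b t d) :
    domBy N Z (s * b * t) d t := by
  obtain ⟨btd, -, -, -, hdt, htd⟩ := h₂
  have hrd : s * b * t * d = s * b := by
    rw [show s * b * t * d = s * (b * t * d) by simp only [mul_assoc], btd]
  refine ⟨by rw [hrd], ?_, by rw [hrd]; exact h.zSubN hsb, ?_, htd, hdt⟩
  · calc t * d * (s * b * t) = t * d * (s * b) * t := by simp only [mul_assoc]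
      _ = s * (b * t * d) * t := by
        rw [h.zComm _ htd _ (h.zSubN hsb)]; simp only [mul_assoc]
      _ = s * b * t := by rw [btd]
  · rw [← mul_assoc]
    exact h.zSubN (h.binormal d t hdt htd _ hsb).1

theorem upClo_dualSet_subset [Semigroup S] {N Z : Set S} (h : Structured N Z)
    (hdiag : IsDiagonal N) (C : Set S) :
    upClo N Z (dualSet N Z C) ⊆ dualSet N Z C := by
  rintro d ⟨s, ⟨c, hc, b, h₁⟩, t, h₂⟩
  exact ⟨c, hc, _, domBy_of_domBy_dual h hdiag h₁ h₂⟩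

theorem dualSet_dualSet [Semigroup S] {N Z : Set S} (h : Structured N Z)
    (hdiag : IsDiagonal N) (C : Set S) :
    dualSet N Z (dualSet N Z C) = upClo N Z (upClo N Z C) := by
  apply Set.Subset.antisymm
  · rintro t ⟨s, ⟨c, hc, b, h₁⟩, d, h₂⟩
    exact ⟨_, ⟨c, hc, d, domBy_of_domBy_dual h hdiag h₁ h₂⟩, d, domBy_mul_of_domBy_dual h h₁ h₂⟩
  · rintro d ⟨b, ⟨c, hc, s, h₁⟩, t, h₂⟩
    exact ⟨_, ⟨c, hc, d, domBy_trans h h₁ h₂⟩, t, domBy_mul_of_mem h h₁.2.2.2.2.2 h₂⟩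

theorem upClo_mono [Semigroup S] {N Z A B : Set S} (hAB : A ⊆ B) :
    upClo N Z A ⊆ upClo N Z B :=
  fun _ ⟨a, ha, hab⟩ => ⟨a, hAB ha, hab⟩

theorem stmt10 [Semigroup S] (N Z : Set S) (h : Structured N Z)
    (hdiag : IsDiagonal N) (C : Set S) :
    upClo N Z (dualSet N Z C) ⊆ dualSet N Z C ∧
    dualSet N Z (dualSet N Z C) = upClo N Z (upClo N Z C) ∧
    dualSet N Z (dualSet N Z (dualSet N Z C)) ⊆ dualSet N Z C := by
  have hup := upClo_dualSet_subset h hdiag C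
  refine ⟨hup, dualSet_dualSet h hdiag C, ?_⟩
  rw [dualSet_dualSet h hdiag (dualSet N Z C)]
  exact (upClo_mono hup).trans hup
end

section
/- In a structured semigroup (S, N, Z), if A ⊆ S is an atlas and n ∈ N, then A|n holds if and only if n ∈ s(A); moreover if n ∈ s(A) then (An)^< = A^<, where An = A{n}. -/
open Pointwise

variable {S : Type*}

/-- Domination is transitive, the witness being that of the upper relation. -/
theorem domBy.trans_domRel [Semigroup S] {N Z : Set S} (h : Structured N Z) {a b c t : S}
    (hab : domRel N Z a b) (hbc : domBy N Z b t c) : domBy N Z a t c := by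
  obtain ⟨s, h1, h2, h3, h4, -, -⟩ := hab
  obtain ⟨k1, k2, k3, k4, k5, k6⟩ := hbc
  refine ⟨?_, ?_, ?_, ?_, k5, k6⟩
  · calc a * t * c = a * s * b * t * c := by rw [h1]
      _ = a * s * (b * t * c) := by simp only [mul_assoc]
      _ = a := by rw [k1, h1]
  · calc c * t * a = c * t * (b * s * a) := by rw [h2]
      _ = c * t * b * s * a := by simp only [mul_assoc]
      _ = a := by rw [k2, h2]
  · have e : a * t = a * s * (b * t) := by rw [← mul_assoc, h1]
    rw [e]
    exact h.nMul _ h3 _ k3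
  · have e : t * a = t * b * (s * a) := by
      rw [mul_assoc, ← mul_assoc b, h2]
    rw [e]
    exact h.nMul _ k4 _ h4

theorem domRel.trans [Semigroup S] {N Z : Set S} (h : Structured N Z) {a b c : S}
    (hab : domRel N Z a b) (hbc : domRel N Z b c) : domRel N Z a c :=
  let ⟨t, ht⟩ := hbc
  ⟨t, ht.trans_domRel h hab⟩

theorem upClo_subset_of_subset [Semigroup S] {N Z : Set S} (h : Structured N Z) {A B : Set S}
    (hAB : A ⊆ upClo N Z B) : upClo N Z A ⊆ upClo N Z B := by
  rintro d ⟨a, ha, had⟩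
  obtain ⟨b, hb, hba⟩ := hAB ha
  exact ⟨b, hb, hba.trans h had⟩

theorem domBy.conj_mem [Semigroup S] {N Z : Set S} (h : Structured N Z) {a s b n : S}
    (hab : domBy N Z a s b) (hn : n ∈ N) : a * n * s ∈ N := by
  obtain ⟨h1, h2, -, h4, h5, h6⟩ := hab
  have hfix : s * b * (s * a * n) = s * a * n := by
    calc s * b * (s * a * n) = s * (b * s * a) * n := by simp only [mul_assoc]
      _ = s * a * n := by rw [h2]
  have hm := h.trinormal s b (s * a * n) (h.nMul _ h4 _ hn) hfix
    (by rw [mul_assoc, ← h.zComm _ h6 _ (h.nMul _ h4 _ hn), hfix]) h6 h5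
  have e : b * (s * a * n) * s = a * n * s := by
    calc b * (s * a * n) * s = b * s * a * n * s := by simp only [mul_assoc]
      _ = a * n * s := by rw [h2]
  rwa [e] at hm

theorem domBy.conj_mem' [Semigroup S] {N Z : Set S} (h : Structured N Z) {a s b n : S}
    (hab : domBy N Z a s b) (hn : n ∈ N) : s * n * a ∈ N := by
  obtain ⟨h1, h2, h3, -, h5, h6⟩ := hab
  have hfix : n * (a * s) * b * s = n * (a * s) := by
    calc n * (a * s) * b * s = n * (a * s * b) * s := by simp only [mul_assoc]
      _ = n * (a * s) := by rw [h1, mul_assoc]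
  have hm := h.trinormal b s (n * (a * s)) (h.nMul _ hn _ h3)
    (by rw [h.zComm _ h5 _ (h.nMul _ hn _ h3), ← mul_assoc, hfix]) hfix h5 h6
  have e : s * (n * (a * s)) * b = s * n * a := by
    calc s * (n * (a * s)) * b = s * n * (a * s * b) := by simp only [mul_assoc]
      _ = s * n * a := by rw [h1]
  rwa [e] at hm

/-- Domination is compatible with products. -/
theorem domBy.mul [Semigroup S] {N Z : Set S} (h : Structured N Z) {a s b c t d : S}
    (hab : domBy N Z a s b) (hcd : domBy N Z c t d) :
    domBy N Z (a * c) (t * s) (b * d) := by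
  have hN := hab.conj_mem h hcd.2.2.1
  have hN' := hcd.conj_mem' h hab.2.2.2.1
  obtain ⟨h1, h2, h3, h4, h5, h6⟩ := hab
  obtain ⟨k1, k2, k3, k4, k5, k6⟩ := hcd
  refine ⟨?_, ?_, ?_, ?_, ?_, ?_⟩
  · calc a * c * (t * s) * (b * d) = a * (c * t * (s * b)) * d := by simp only [mul_assoc]
      _ = a * (s * b * (c * t)) * d := by rw [h.zComm _ h6 _ k3]
      _ = a * s * b * (c * t * d) := by simp only [mul_assoc]
      _ = a * c := by rw [h1, k1]
  · calc b * d * (t * s) * (a * c) = b * (d * t * (s * a)) * c := by simp only [mul_assoc]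
      _ = b * (s * a * (d * t)) * c := by rw [h.zComm _ k5 _ h4]
      _ = b * s * a * (d * t * c) := by simp only [mul_assoc]
      _ = a * c := by rw [h2, k2]
  · simpa only [mul_assoc] using hN
  · simpa only [mul_assoc] using hN'
  · simpa only [mul_assoc] using (h.binormal b s h5 h6 _ k5).1
  · simpa only [mul_assoc] using (h.binormal d t k5 k6 _ h6).2

/-- If `n ∈ N` and `z = z n n'` with `z, n n', n' n ∈ Z`, then also `z = z n' n`. -/
theorem Structured.mul_swap_eq [Semigroup S] {N Z : Set S} (h : Structured N Z) {n n' z : S}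
    (hn : n ∈ N) (he : n * n' ∈ Z) (hf : n' * n ∈ Z) (hz : z * (n * n') = z) :
    z * (n' * n) = z := by
  have hcomm : n' * n * n = n * (n' * n) := h.zComm _ hf _ hn
  calc z * (n' * n) = z * (n * n') * (n' * n) := by rw [hz]
    _ = z * (n * n' * (n' * n)) := by rw [mul_assoc]
    _ = z * (n' * n * (n * n')) := by rw [h.zComm _ he _ (h.zSubN hf)]
    _ = z * (n' * n * n * n') := by simp only [mul_assoc]
    _ = z * (n * (n' * n) * n') := by rw [hcomm]
    _ = z * (n * n') * (n * n') := by simp only [mul_assoc]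
    _ = z := by rw [hz, hz]

theorem mem_srcSet_of_actsR [Semigroup S] {N Z : Set S} (h : Structured N Z) {A : Set S}
    (hA : A ⊆ upClo N Z A) {n : S} (hn : n ∈ N) (hact : actsR Z A n) : n ∈ srcSet N Z A := by
  obtain ⟨n', he, hf, a, ha, hae⟩ := hact
  obtain ⟨a₁, ha₁, s, hs⟩ := hA ha
  have hN := hs.conj_mem h hn
  obtain ⟨h1, h2, h3, h4, h5, h6⟩ := hs
  have hze : s * a * (n * n') = s * a := by
    rw [mul_assoc, ← mul_assoc a, hae]
  have hzf := h.mul_swap_eq hn he hf hze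
  have hzn := h.zComm _ h6 _ hn
  have hzen : n * (s * a) * n' = s * a := by rw [← hzn, mul_assoc, hze]
  have hfz : n' * n * (s * a) = s * a := by rw [h.zComm _ hf _ (h.zSubN h6), hzf]
  have ha₁f : a₁ * (n' * n) = a₁ := by
    calc a₁ * (n' * n) = a₁ * s * a * (n' * n) := by rw [h1]
      _ = a₁ * (s * a * (n' * n)) := by simp only [mul_assoc]
      _ = a₁ := by rw [hzf, ← mul_assoc, h1]
  have hdual : n * s ∈ dualSet N Z A := by
    refine ⟨a₁, ha₁, a * n', ?_, ?_, ?_, ?_, ?_, ?_⟩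
    · calc a₁ * (n * s) * (a * n') = a₁ * (n * (s * a) * n') := by simp only [mul_assoc]
        _ = a₁ := by rw [hzen, ← mul_assoc, h1]
    · calc a * n' * (n * s) * a₁ = a * (n' * n * (s * a₁)) := by simp only [mul_assoc]
        _ = a * (s * a₁ * (n' * n)) := by rw [h.zComm _ hf _ h4]
        _ = a * s * (a₁ * (n' * n)) := by simp only [mul_assoc]
        _ = a₁ := by rw [ha₁f, h2]
    · rwa [← mul_assoc]
    · rw [mul_assoc]
      exact h.nMul _ hn _ h4
    · simpa only [mul_assoc] using (h.binormal a s h5 h6 _ hf).1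
    · simpa only [mul_assoc] using (h.binormal n n' he hf _ h6).1
  refine ⟨n * s * a, Set.mul_mem_mul hdual ha, n', ?_, ?_, ?_, ?_, he, hf⟩
  · calc n * s * a * n' * n = n * (s * a) * n' * n := by simp only [mul_assoc]
      _ = n * s * a := by rw [hzen, hzn, mul_assoc]
  · calc n * n' * (n * s * a) = n * (n' * n * (s * a)) := by simp only [mul_assoc]
      _ = n * s * a := by rw [hfz, mul_assoc]
  · rw [mul_assoc n, hzen]
    exact h.zSubN h6
  · rw [mul_assoc n, ← mul_assoc, hfz]
    exact h.zSubN h6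

theorem actsR_of_mem_srcSet [Semigroup S] {N Z : Set S} (h : Structured N Z) {A : Set S}
    (hA : A * dualSet N Z A * A ⊆ A) {n : S} (hn : n ∈ N) (hsrc : n ∈ srcSet N Z A) :
    actsR Z A n := by
  obtain ⟨_, ⟨s, hs, c, hc, rfl⟩, n', h1, h2, h3, -, h5, h6⟩ := hsrc
  obtain ⟨a, ha, -⟩ := id hs
  dsimp only at h1 h2 h3
  have hpN : s * c ∈ N := h1 ▸ h.nMul _ h3 _ hn
  have hfix : s * c * (n * n') = s * c := by rw [← h.zComm _ h5 _ hpN, h2]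
  refine ⟨n', h5, h6, a * s * c, hA (Set.mul_mem_mul (Set.mul_mem_mul ha hs) hc), ?_⟩
  calc a * s * c * n * n' = a * (s * c * (n * n')) := by simp only [mul_assoc]
    _ = a * s * c := by rw [hfix, mul_assoc]

theorem stmt14 [Semigroup S] (N Z : Set S) (h : Structured N Z) (A : Set S)
    (hA : IsAtlas N Z A) (n : S) (hn : n ∈ N) :
    (actsR Z A n ↔ n ∈ srcSet N Z A) ∧
    (n ∈ srcSet N Z A → upClo N Z (A * {n}) = upClo N Z A) := by
  have hsub : A ⊆ upClo N Z (A * {n}) := by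
    intro c hc
    obtain ⟨c₁, hc₁, t, ht⟩ := hA.2 hc
    have hN := ht.conj_mem h hn
    obtain ⟨h1, h2, -, h4, h5, h6⟩ := ht
    refine ⟨c₁ * n, Set.mul_mem_mul hc₁ rfl, t, ?_, ?_, hN, ?_, h5, h6⟩
    · rw [mul_assoc, mul_assoc, ← h.zComm _ h6 _ hn, ← mul_assoc, ← mul_assoc, h1]
    · rw [← mul_assoc, h2]
    · rw [← mul_assoc]
      exact h.nMul _ h4 _ hn
  refine ⟨⟨mem_srcSet_of_actsR h hA.2 hn, actsR_of_mem_srcSet h hA.1 hn⟩, fun hsrc =>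
    (upClo_subset_of_subset h ?_).antisymm (upClo_subset_of_subset h hsub)⟩
  obtain ⟨_, ⟨s, hs, b, hb, rfl⟩, n', hpn⟩ := hsrc
  rintro _ ⟨c, hc, _, rfl, rfl⟩
  obtain ⟨c₁, hc₁, t, ht⟩ := hA.2 hc
  refine ⟨c₁ * s * b, hA.1 (Set.mul_mem_mul (Set.mul_mem_mul hc₁ hs) hb), n' * t, ?_⟩
  simpa only [mul_assoc] using ht.mul h hpn
end
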